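/- Let M ≥ 3 be an integer, let c, f_c, d, R_D be positive reals, θ_D a real with cos θ_D > 0, and δ > 0 a real. Choose frequency offsets Δf_m = (δ/2)·|sin(m−1)|/π + (f_c·d²/(2R_D²))·(m−1)², so that ξ_m = Δf_m − (d²f_c/(2R_D²))(m−1)² = (δ/2)·|sin(m−1)|/π for m = 1,…,M, and define X = (2π²/c²)·∑_{m=1}^{M}∑_{n=1}^{M} (2(ξ_m − ξ_n))², Y = (4π²·d·f_c·cos θ_D/c²)·∑_{m=1}^{M}∑_{n=1}^{M} 2(ξ_m − ξ_n)(m−n), Z = (8π²·f_c²·d²·cos²θ_D/c²)·∑_{m=1}^{M}∑_{n=1}^{M} (m−n)². Let X_fa, Y_fa, Z_fa be the same quantities with ξ_m replaced by η_m = |sin(m−1)|/π. Then X_fa·Z_fa − Y_fa² > 0, XZ − Y² > 0, the range-dimension beamwidth satisfies 2√(M²Z/(XZ − Y²)) = (4/δ)·√(M²·Z_fa/(X_fa·Z_fa − Y_fa²)), and the angular-dimension beamwidth satisfies 2√(M²X/(XZ − Y²)) = 2√(M²·X_fa/(X_fa·Z_fa − Y_fa²)). -/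

import Mathlib

open Real Finset

/-- Coefficient `X` of the half-power boundary quadratic form of Lemma 1. -/
noncomputable def coefX (c : ℝ) (M : ℕ) (ξ : ℕ → ℝ) : ℝ :=
  (2 * π ^ 2 / c ^ 2) * ∑ m ∈ Icc 1 M, ∑ n ∈ Icc 1 M, (2 * (ξ m - ξ n)) ^ 2

/-- Coefficient `Y` of the half-power boundary quadratic form of Lemma 1. -/
noncomputable def coefY (c d f_c θ_D : ℝ) (M : ℕ) (ξ : ℕ → ℝ) : ℝ :=
  (4 * π ^ 2 * d * f_c * Real.cos θ_D / c ^ 2) *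
    ∑ m ∈ Icc 1 M, ∑ n ∈ Icc 1 M, 2 * (ξ m - ξ n) * ((m : ℝ) - (n : ℝ))

/-- Coefficient `Z` of the half-power boundary quadratic form of Lemma 1. -/
noncomputable def coefZ (c d f_c θ_D : ℝ) (M : ℕ) : ℝ :=
  (8 * π ^ 2 * f_c ^ 2 * d ^ 2 * Real.cos θ_D ^ 2 / c ^ 2) *
    ∑ m ∈ Icc 1 M, ∑ n ∈ Icc 1 M, ((m : ℝ) - (n : ℝ)) ^ 2

/-- Strict Cauchy–Schwarz inequality for finite sums of nonproportional families. -/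
theorem sum_mul_sq_lt_of_mul_ne {ι : Type*} (s : Finset ι) (f g : ι → ℝ) {i j : ι}
    (hi : i ∈ s) (hj : j ∈ s) (hij : f i * g j ≠ f j * g i) :
    (∑ k ∈ s, f k * g k) ^ 2 < (∑ k ∈ s, f k ^ 2) * ∑ k ∈ s, g k ^ 2 := by
  have lagrange : ∑ k ∈ s, ∑ l ∈ s, (f k * g l - f l * g k) ^ 2 =
      2 * ((∑ k ∈ s, f k ^ 2) * (∑ k ∈ s, g k ^ 2) - (∑ k ∈ s, f k * g k) ^ 2) := by
    have expand : ∀ k l, (f k * g l - f l * g k) ^ 2 =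
        f k ^ 2 * g l ^ 2 + g k ^ 2 * f l ^ 2 - 2 * ((f k * g k) * (f l * g l)) := by
      intro k l
      ring
    simp only [expand, Finset.sum_sub_distrib, Finset.sum_add_distrib, ← Finset.mul_sum,
      ← Finset.sum_mul]
    ring
  have pos : 0 < ∑ k ∈ s, ∑ l ∈ s, (f k * g l - f l * g k) ^ 2 :=
    Finset.sum_pos' (fun k _ => Finset.sum_nonneg fun l _ => sq_nonneg _)
      ⟨i, hi, Finset.sum_pos' (fun l _ => sq_nonneg _)
        ⟨j, hj, by have := sub_ne_zero.mpr hij; positivity⟩⟩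
  linarith

theorem coefX_const_mul (c a : ℝ) (M : ℕ) (ξ : ℕ → ℝ) :
    coefX c M (fun m => a * ξ m) = a ^ 2 * coefX c M ξ := by
  simp only [coefX, Finset.mul_sum]
  refine Finset.sum_congr rfl fun m _ => Finset.sum_congr rfl fun n _ => ?_
  ring

theorem coefY_const_mul (c d f_c θ_D a : ℝ) (M : ℕ) (ξ : ℕ → ℝ) :
    coefY c d f_c θ_D M (fun m => a * ξ m) = a * coefY c d f_c θ_D M ξ := by
  simp only [coefY, Finset.mul_sum]
  refine Finset.sum_congr rfl fun m _ => Finset.sum_congr rfl fun n _ => ?_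
  ring

/-- The half-power quadratic form is nondegenerate as soon as the first three frequency offsets
are not in arithmetic progression. -/
theorem coefX_mul_coefZ_sub_coefY_sq_pos {c d f_c θ_D : ℝ} {M : ℕ} (hM : 3 ≤ M)
    (hc : c ≠ 0) (hd : d ≠ 0) (hf : f_c ≠ 0) (hθ : Real.cos θ_D ≠ 0) {ξ : ℕ → ℝ}
    (hξ : 2 * (ξ 2 - ξ 1) ≠ ξ 3 - ξ 1) :
    0 < coefX c M ξ * coefZ c d f_c θ_D M - coefY c d f_c θ_D M ξ ^ 2 := by
  have cauchy := sum_mul_sq_lt_of_mul_ne (Icc 1 M ×ˢ Icc 1 M)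
    (fun p : ℕ × ℕ => 2 * (ξ p.1 - ξ p.2)) (fun p : ℕ × ℕ => (p.1 : ℝ) - (p.2 : ℝ))
    (i := (2, 1)) (j := (3, 1))
    (by simp only [Finset.mem_product, Finset.mem_Icc]; omega)
    (by simp only [Finset.mem_product, Finset.mem_Icc]; omega)
    (by
      intro h
      apply hξ
      norm_num at h
      linarith)
  simp only [Finset.sum_product] at cauchy
  have factor : 0 < 16 * π ^ 4 * d ^ 2 * f_c ^ 2 * Real.cos θ_D ^ 2 / c ^ 4 := by
    positivity
  refine (mul_pos factor (sub_pos.mpr cauchy)).trans_eq ?_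
  simp only [coefX, coefY, coefZ]
  ring

theorem abs_sin_two_lt : |Real.sin 2| < 2 * |Real.sin 1| := by
  have sin_one_pos : 0 < Real.sin 1 :=
    Real.sin_pos_of_pos_of_lt_pi one_pos (by linarith [Real.pi_gt_three])
  have double : Real.sin 2 = 2 * Real.sin 1 * Real.cos 1 := by
    rw [← Real.sin_two_mul, mul_one]
  rw [double, abs_mul, abs_mul, abs_two, abs_of_pos Real.cos_one_pos, abs_of_pos sin_one_pos]
  nlinarith [Real.cos_one_le]

/-- Proposition 2 (with the scaling constant made exact): with frequency offsets
`Δf_m = (δ/2)·|sin(m−1)|/π + (f_c d²/(2R_D²))·(m−1)²`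
(so `ξ_m = (δ/2)·|sin(m−1)|/π`), for `M ≥ 3` and `δ > 0`, both `X_fa Z_fa − Y_fa² > 0`
and `XZ − Y² > 0` hold, the range-dimension beamwidth equals
`(4/δ)·√(M²Z_fa/(X_fa Z_fa − Y_fa²))`, and the angular-dimension beamwidth equals
`2√(M²X_fa/(X_fa Z_fa − Y_fa²))`, where `X_fa, Y_fa, Z_fa` are the coefficients
obtained from `η_m = |sin(m−1)|/π`. -/
theorem proposition2_beamwidths (M : ℕ) (hM : 3 ≤ M) (c f_c d R_D θ_D δ : ℝ)
    (hc : 0 < c) (hf : 0 < f_c) (hd : 0 < d) (hR : 0 < R_D)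
    (hθ : 0 < Real.cos θ_D) (hδ : 0 < δ) :
    let η : ℕ → ℝ := fun m => |Real.sin ((m : ℝ) - 1)| / π
    let ξ : ℕ → ℝ := fun m => (δ / 2) * (|Real.sin ((m : ℝ) - 1)| / π)
    let X := coefX c M ξ
    let Y := coefY c d f_c θ_D M ξ
    let Z := coefZ c d f_c θ_D M
    let Xfa := coefX c M η
    let Yfa := coefY c d f_c θ_D M η
    let Zfa := coefZ c d f_c θ_D M
    0 < Xfa * Zfa - Yfa ^ 2 ∧
    0 < X * Z - Y ^ 2 ∧
    2 * Real.sqrt ((M : ℝ) ^ 2 * Z / (X * Z - Y ^ 2)) =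
      (4 / δ) * Real.sqrt ((M : ℝ) ^ 2 * Zfa / (Xfa * Zfa - Yfa ^ 2)) ∧
    2 * Real.sqrt ((M : ℝ) ^ 2 * X / (X * Z - Y ^ 2)) =
      2 * Real.sqrt ((M : ℝ) ^ 2 * Xfa / (Xfa * Zfa - Yfa ^ 2)) := by
  intro η ξ X Y Z Xfa Yfa Zfa
  have hη : 2 * (η 2 - η 1) ≠ η 3 - η 1 := by
    have h := div_lt_div_of_pos_right abs_sin_two_lt Real.pi_pos
    simp only [η]
    norm_num
    intro heq
    rw [mul_div_assoc, heq] at h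
    exact lt_irrefl _ h
  have posfa : 0 < Xfa * Zfa - Yfa ^ 2 :=
    coefX_mul_coefZ_sub_coefY_sq_pos hM hc.ne' hd.ne' hf.ne' hθ.ne' hη
  have hX : X = (δ / 2) ^ 2 * Xfa := coefX_const_mul c (δ / 2) M η
  have hY : Y = (δ / 2) * Yfa := coefY_const_mul c d f_c θ_D (δ / 2) M η
  have det : X * Z - Y ^ 2 = (δ / 2) ^ 2 * (Xfa * Zfa - Yfa ^ 2) := by
    rw [hX, hY]
    ring
  have hδ2 : 0 < (δ / 2) ^ 2 := by positivity
  refine ⟨posfa, det ▸ mul_pos hδ2 posfa, ?_, ?_⟩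
  · have ratio : (M : ℝ) ^ 2 * Z / (X * Z - Y ^ 2) =
        (2 / δ) ^ 2 * ((M : ℝ) ^ 2 * Zfa / (Xfa * Zfa - Yfa ^ 2)) := by
      rw [det]
      field_simp
      rfl
    rw [ratio, Real.sqrt_mul (sq_nonneg _), Real.sqrt_sq (by positivity)]
    ring
  · rw [det, hX, mul_left_comm, mul_div_mul_left _ _ hδ2.ne']
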